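/- Let G and H be two pseudoforests on the same finite vertex set V with deg_G(v) = deg_H(v) for every v ∈ V. Then there exists a finite sequence of graphs G = G_0, G_1, ..., G_r = H on V such that every G_i is a pseudoforest and, for each i, G_{i+1} is obtained from G_i by a 2-switch. (Equivalently, the subgraph P(d) of the realization graph induced by pseudoforests is connected.) -/

import Mathlib

open SimpleGraph

variable {V : Type*}

/-- The graph obtained from `G` by the 2-switch deleting the edges `ab`, `cd`
and adding the edges `ac`, `bd`. -/
def switched (G : SimpleGraph V) (a b c d : V) : SimpleGraph V :=
  SimpleGraph.fromEdgeSet ((G.edgeSet \ {s(a, b), s(c, d)}) ∪ {s(a, c), s(b, d)})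

/-- `a, b, c, d` form a valid 2-switch configuration in `G`: they are four distinct
vertices with `ab, cd ∈ E(G)` and `ac, bd ∉ E(G)`. -/
def IsSwitchPair (G : SimpleGraph V) (a b c d : V) : Prop :=
  a ≠ b ∧ a ≠ c ∧ a ≠ d ∧ b ≠ c ∧ b ≠ d ∧ c ≠ d ∧
    G.Adj a b ∧ G.Adj c d ∧ ¬ G.Adj a c ∧ ¬ G.Adj b d

/-- `H` is obtained from `G` by a 2-switch. -/
def TwoSwitch (G H : SimpleGraph V) : Prop :=
  ∃ a b c d : V, IsSwitchPair G a b c d ∧ H = switched G a b c d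

/-- `s` is the edge set of some cycle of `G`. -/
def IsCycleEdgeSet (G : SimpleGraph V) (s : Set (Sym2 V)) : Prop :=
  ∃ (v : V) (w : G.Walk v v), w.IsCycle ∧ s = {e | e ∈ w.edges}

/-- Every connected component of `G` contains at most one cycle: any two cycles
lying in the same component have the same edge set. -/
def IsPseudoforest (G : SimpleGraph V) : Prop :=
  ∀ (u v : V) (p : G.Walk u u) (q : G.Walk v v),
    p.IsCycle → q.IsCycle → G.Reachable u v → {e | e ∈ p.edges} = {e | e ∈ q.edges}

/-- `G` is connected and contains exactly one cycle. -/
def IsUnicyclic (G : SimpleGraph V) : Prop :=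
  G.Connected ∧ ∃! s : Set (Sym2 V), IsCycleEdgeSet G s

/-- The number of connected components of `G`. -/
noncomputable def kappa (G : SimpleGraph V) : ℕ :=
  Nat.card G.ConnectedComponent

/-- The number of connected components of `G` containing a cycle. -/
noncomputable def cyc (G : SimpleGraph V) : ℕ :=
  Nat.card {C : G.ConnectedComponent // ∃ (v : V) (w : G.Walk v v),
    G.connectedComponentMk v = C ∧ w.IsCycle}

/-- Every edge of `G` joins some vertex `a` to `f a`. -/
def OrientedBy (G : SimpleGraph V) (f : V → V) : Prop :=
  ∀ ⦃a b⦄, G.Adj a b → f a = b ∨ f b = a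

theorem OrientedBy.exists_of_mem_edges {G : SimpleGraph V} {f : V → V} (hf : OrientedBy G f)
    {u : V} {p : G.Walk u u} {e : Sym2 V} (he : e ∈ p.edges) :
    ∃ a ∈ p.support, e = s(a, f a) := by
  induction e with | _ a b
  rcases hf (p.adj_of_mem_edges he) with h | h
  · exact ⟨a, p.fst_mem_support_of_mem_edges he, by rw [h]⟩
  · exact ⟨b, p.snd_mem_support_of_mem_edges he, by rw [h, Sym2.eq_swap]⟩

theorem OrientedBy.mk_mem_edges {G : SimpleGraph V} {f : V → V} (hf : OrientedBy G f)
    {u : V} {p : G.Walk u u} (hp : p.IsCycle) {a : V} (ha : a ∈ p.support) :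
    s(a, f a) ∈ p.edges := by
  classical
  have hsupp : ∀ x ∈ p.support, x ∈ p.support.tail := by
    intro x hx
    rw [← p.cons_tail_support, List.mem_cons] at hx
    rcases hx with rfl | hx
    · exact p.end_mem_tail_support hp.not_nil
    · exact hx
  have hsub : p.edges.toFinset ⊆ p.support.tail.toFinset.image fun x => s(x, f x) := by
    intro e he
    obtain ⟨x, hx, rfl⟩ := hf.exists_of_mem_edges (List.mem_toFinset.1 he)
    exact Finset.mem_image_of_mem _ (List.mem_toFinset.2 (hsupp x hx))
  have hcard : (p.support.tail.toFinset.image fun x => s(x, f x)).card ≤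
      p.edges.toFinset.card := by
    refine Finset.card_image_le.trans ?_
    rw [List.toFinset_card_of_nodup hp.support_nodup,
      List.toFinset_card_of_nodup hp.isCircuit.isTrail.edges_nodup]
    simp
  rw [← List.mem_toFinset, Finset.eq_of_subset_of_card_le hsub hcard]
  exact Finset.mem_image_of_mem _ (List.mem_toFinset.2 (hsupp a ha))

theorem OrientedBy.exists_mem_support_eq {G : SimpleGraph V} {f : V → V} (hf : OrientedBy G f)
    {u : V} {p : G.Walk u u} (hp : p.IsCycle) {a : V} (ha : a ∈ p.support) :
    ∃ b ∈ p.support, f b = a := by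
  obtain ⟨b, hb, hne⟩ := Set.exists_ne_of_one_lt_ncard
    (by rw [hp.ncard_neighborSet_toSubgraph_eq_two ha]; decide) (f a)
  have hab : s(a, b) ∈ p.edges := Walk.adj_toSubgraph_iff_mem_edges.1 hb
  have hadj := p.adj_of_mem_edges hab
  exact ⟨b, p.snd_mem_support_of_mem_edges hab, (hf hadj).resolve_left fun h => hne h.symm⟩

theorem OrientedBy.iterate_mem_support {G : SimpleGraph V} {f : V → V} (hf : OrientedBy G f)
    {u : V} {p : G.Walk u u} (hp : p.IsCycle) {a : V} (ha : a ∈ p.support) (n : ℕ) :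
    f^[n] a ∈ p.support := by
  induction n with
  | zero => exact ha
  | succ n ih =>
    rw [Function.iterate_succ_apply']
    exact p.snd_mem_support_of_mem_edges (hf.mk_mem_edges hp ih)

theorem OrientedBy.exists_iterate_iterate_eq {G : SimpleGraph V} {f : V → V}
    (hf : OrientedBy G f) {u : V} {p : G.Walk u u} (hp : p.IsCycle) {a : V} (ha : a ∈ p.support)
    (m : ℕ) : ∃ k, f^[k] (f^[m] a) = a := by
  have hmem (x : {x // x ∈ p.support}) : f x ∈ p.support :=
    p.snd_mem_support_of_mem_edges (hf.mk_mem_edges hp x.2)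
  let g : {x // x ∈ p.support} → {x // x ∈ p.support} := fun x => ⟨f x, hmem x⟩
  have hsurj : Function.Surjective g := by
    rintro ⟨x, hx⟩
    obtain ⟨b, hb, h⟩ := hf.exists_mem_support_eq hp hx
    exact ⟨⟨b, hb⟩, Subtype.ext h⟩
  have : Finite {x // x ∈ p.support} := p.support.finite_toSet
  obtain ⟨n, hn, hper⟩ := (Finite.injective_iff_surjective.2 hsurj).mem_periodicPts ⟨a, ha⟩
  have hsemi : Function.Semiconj (Subtype.val : {x // x ∈ p.support} → V) g f := fun _ => rfl
  have hfa : Function.IsPeriodicPt f n a := hper.map hsemi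
  refine ⟨m * n - m, ?_⟩
  rw [← Function.iterate_add_apply, Nat.sub_add_cancel (Nat.le_mul_of_pos_right m hn)]
  exact hfa.const_mul m

theorem OrientedBy.exists_iterate_eq_of_reachable {G : SimpleGraph V} {f : V → V}
    (hf : OrientedBy G f) {a b : V} (h : G.Reachable a b) : ∃ m n, f^[m] a = f^[n] b := by
  obtain ⟨p⟩ := h
  induction p with
  | nil => exact ⟨0, 0, rfl⟩
  | cons hadj _ ih =>
    obtain ⟨m, n, h⟩ := ih
    rcases hf hadj with h' | h'
    · exact ⟨m + 1, n, by rw [Function.iterate_succ_apply, h', h]⟩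
    · refine ⟨m, n + 1, ?_⟩
      rw [Function.iterate_succ_apply', ← h, ← Function.iterate_succ_apply' f,
        Function.iterate_succ_apply, h']

theorem OrientedBy.edges_subset {G : SimpleGraph V} {f : V → V} (hf : OrientedBy G f)
    {u v : V} {p : G.Walk u u} {q : G.Walk v v} (hp : p.IsCycle) (hq : q.IsCycle)
    (h : G.Reachable u v) {e : Sym2 V} (he : e ∈ p.edges) : e ∈ q.edges := by
  classical
  obtain ⟨a, ha, rfl⟩ := hf.exists_of_mem_edges he
  obtain ⟨m, n, hmn⟩ :=
    hf.exists_iterate_eq_of_reachable ((p.takeUntil a ha).reachable.symm.trans h)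
  obtain ⟨k, hk⟩ := hf.exists_iterate_iterate_eq hp ha m
  refine hf.mk_mem_edges hq ?_
  rw [← hk, hmn]
  exact hf.iterate_mem_support hq (hf.iterate_mem_support hq q.start_mem_support n) k

theorem OrientedBy.isPseudoforest {G : SimpleGraph V} {f : V → V} (hf : OrientedBy G f) :
    IsPseudoforest G := fun _ _ _ _ hp hq h =>
  Set.ext fun _ => ⟨hf.edges_subset hp hq h, hf.edges_subset hq hp h.symm⟩

theorem IsPseudoforest.mono {G G' : SimpleGraph V} (hG : IsPseudoforest G) (h : G' ≤ G) :
    IsPseudoforest G' := by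
  intro u v p q hp hq huv
  simpa using hG u v (p.mapLe h) (q.mapLe h) (hp.mapLe h) (hq.mapLe h) (huv.mono h)

/-- The connected component of `r` in `G` contains a cycle. -/
def ReachesCycle (G : SimpleGraph V) (r : V) : Prop :=
  ∃ (u : V) (p : G.Walk u u), p.IsCycle ∧ G.Reachable r u

theorem ReachesCycle.mono {G G' : SimpleGraph V} {r : V} (hr : ReachesCycle G' r) (h : G' ≤ G) :
    ReachesCycle G r := by
  obtain ⟨u, p, hp, hru⟩ := hr
  exact ⟨u, p.mapLe h, hp.mapLe h, hru.mono h⟩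

theorem ReachesCycle.of_reachable {G : SimpleGraph V} {r s : V} (hr : ReachesCycle G r)
    (h : G.Reachable s r) : ReachesCycle G s := by
  obtain ⟨u, p, hp, hru⟩ := hr
  exact ⟨u, p, hp, h.trans hru⟩

theorem not_reachesCycle_of_mem_edges {G : SimpleGraph V} (hG : IsPseudoforest G) {a b u : V}
    {p : G.Walk u u} (hp : p.IsCycle) (he : s(a, b) ∈ p.edges) :
    ¬ ReachesCycle (G.deleteEdges {s(a, b)}) a := by
  classical
  rintro ⟨v, q, hq, hav⟩
  have hle := G.deleteEdges_le {s(a, b)}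
  have hua := (p.takeUntil a (p.fst_mem_support_of_mem_edges he)).reachable
  have h := hG _ _ p (q.mapLe hle) hp (hq.mapLe hle) (hua.trans (hav.mono hle))
  have he' : s(a, b) ∈ {e | e ∈ (q.mapLe hle).edges} := h ▸ he
  have he'' : s(a, b) ∈ q.edges := by simpa using he'
  simpa using q.adj_of_mem_edges he''

theorem not_reachesCycle_or_of_not_reachable {G : SimpleGraph V} (hG : IsPseudoforest G)
    {a b : V} (hab : G.Adj a b) (h : ¬ (G.deleteEdges {s(a, b)}).Reachable a b) :
    ¬ ReachesCycle (G.deleteEdges {s(a, b)}) a ∨ ¬ ReachesCycle (G.deleteEdges {s(a, b)}) b := by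
  classical
  by_contra! hc
  obtain ⟨⟨u, p, hp, hau⟩, v, q, hq, hbv⟩ := hc
  have hle := G.deleteEdges_le {s(a, b)}
  have huv := hG _ _ (p.mapLe hle) (q.mapLe hle) (hp.mapLe hle) (hq.mapLe hle)
    ((hau.mono hle).symm.trans (hab.reachable.trans (hbv.mono hle)))
  simp only [Walk.edges_mapLe_eq_edges] at huv
  obtain ⟨e, he⟩ := List.exists_mem_of_ne_nil p.edges
    (by simpa [Walk.edges_eq_nil] using hp.not_nil)
  have he' : e ∈ q.edges := by
    have : e ∈ {e | e ∈ q.edges} := huv ▸ he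
    exact this
  induction e with | _ x y
  have hx := (p.takeUntil x (p.fst_mem_support_of_mem_edges he)).reachable
  have hx' := (q.takeUntil x (q.fst_mem_support_of_mem_edges he')).reachable
  exact h (hau.trans (hx.trans (hx'.symm.trans hbv.symm)))

open Classical in
theorem OrientedBy.update {G : SimpleGraph V} {a b : V} {f : V → V}
    (hf : OrientedBy (G.deleteEdges {s(a, b)}) f) (ha : f a = a) :
    OrientedBy G (Function.update f a b) := by
  intro x y hxy
  by_cases he : s(x, y) = s(a, b)
  · rcases Sym2.eq_iff.1 he with ⟨rfl, rfl⟩ | ⟨rfl, rfl⟩ <;> simp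
  · have h := hf (show (G.deleteEdges {s(a, b)}).Adj x y by simp [hxy, he])
    have := hxy.ne
    grind [Function.update_apply]

/-- A pseudoforest can be oriented with prescribed sinks, provided that these lie in distinct
acyclic components. -/
theorem IsPseudoforest.exists_orientedBy_sinks [Finite V] (G : SimpleGraph V)
    (hG : IsPseudoforest G) (R : Set V) (hR : ∀ r ∈ R, ¬ ReachesCycle G r)
    (hR' : ∀ r ∈ R, ∀ s ∈ R, G.Reachable r s → r = s) :
    ∃ f, OrientedBy G f ∧ ∀ r ∈ R, f r = r := by
  classical
  induction G using WellFoundedLT.induction generalizing R with | _ G ih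
  have key : ∀ a b, G.Adj a b → ¬ ReachesCycle (G.deleteEdges {s(a, b)}) a →
      (∀ r ∈ R, ¬ (G.deleteEdges {s(a, b)}).Reachable a r) →
      ∃ f, OrientedBy G f ∧ ∀ r ∈ R, f r = r := by
    intro a b hab hcyc hreach
    have hle := G.deleteEdges_le {s(a, b)}
    have hlt : G.deleteEdges {s(a, b)} < G := by
      refine lt_of_le_of_ne hle fun h => ?_
      rw [← h] at hab
      simp at hab
    obtain ⟨f, hf, hfR⟩ := ih _ hlt (hG.mono hle) (insert a R) (by
      rintro r (rfl | hr)
      · exact hcyc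
      · exact fun h => hR r hr (h.mono hle)) (by
      rintro r (rfl | hr) s (rfl | hs) h
      · rfl
      · exact absurd h (hreach s hs)
      · exact absurd h.symm (hreach r hr)
      · exact hR' r hr s hs (h.mono hle))
    refine ⟨_, hf.update (hfR a (Set.mem_insert _ _)), fun r hr => ?_⟩
    have hra : r ≠ a := fun h => hreach r hr (h ▸ Reachable.refl _)
    rw [Function.update_of_ne hra, hfR r (Set.mem_insert_of_mem _ hr)]
  rcases eq_or_ne G ⊥ with rfl | hne
  · exact ⟨id, fun a b h => h.elim, fun _ _ => rfl⟩
  obtain ⟨a, b, hab⟩ := ne_bot_iff_exists_adj.1 hne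
  have hle := G.deleteEdges_le {s(a, b)}
  by_cases hbr : (G.deleteEdges {s(a, b)}).Reachable a b
  · obtain ⟨u, p, hp, he⟩ := adj_and_reachable_delete_edges_iff_exists_cycle.1 ⟨hab, hbr⟩
    have hua := (p.takeUntil a (p.fst_mem_support_of_mem_edges he)).reachable
    exact key a b hab (not_reachesCycle_of_mem_edges hG hp he) fun r hr h =>
      hR r hr ⟨u, p, hp, (h.mono hle).symm.trans hua.symm⟩
  · by_contra hcon
    have hor := not_reachesCycle_or_of_not_reachable hG hab hbr
    have hA (h : ¬ ReachesCycle (G.deleteEdges {s(a, b)}) a) :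
        ∃ r ∈ R, (G.deleteEdges {s(a, b)}).Reachable a r := by
      by_contra! h'
      exact hcon (key a b hab h h')
    have hB (h : ¬ ReachesCycle (G.deleteEdges {s(a, b)}) b) :
        ∃ r ∈ R, (G.deleteEdges {s(a, b)}).Reachable b r := by
      by_contra! h'
      rw [Sym2.eq_swap] at h h'
      exact hcon (key b a hab.symm h h')
    by_cases ha : ReachesCycle (G.deleteEdges {s(a, b)}) a
    · have hb := hor.resolve_left (not_not.2 ha)
      obtain ⟨r, hr, h⟩ := hB hb
      exact hR r hr ((ha.mono hle).of_reachable ((h.mono hle).symm.trans hab.symm.reachable))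
    · obtain ⟨r, hr, h⟩ := hA ha
      by_cases hb : ReachesCycle (G.deleteEdges {s(a, b)}) b
      · exact hR r hr ((hb.mono hle).of_reachable ((h.mono hle).symm.trans hab.reachable))
      · obtain ⟨s, hs, h'⟩ := hB hb
        have := hR' r hr s hs ((h.mono hle).symm.trans (hab.reachable.trans (h'.mono hle)))
        exact hbr (h.trans (this ▸ h'.symm))

theorem isPseudoforest_iff_exists_orientedBy [Finite V] {G : SimpleGraph V} :
    IsPseudoforest G ↔ ∃ f, OrientedBy G f := by
  refine ⟨fun hG => ?_, fun ⟨_, hf⟩ => hf.isPseudoforest⟩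
  obtain ⟨f, hf, -⟩ := hG.exists_orientedBy_sinks G ∅ (by simp) (by simp)
  exact ⟨f, hf⟩

theorem mk_mem_edges_of_ncard_le_two [Finite V] {G : SimpleGraph V}
    (hG : ∀ v, (G.neighborSet v).ncard ≤ 2) {u : V} {p : G.Walk u u} (hp : p.IsCycle) {a b : V}
    (ha : a ∈ p.support) (hab : G.Adj a b) : s(a, b) ∈ p.edges := by
  have h := Set.eq_of_subset_of_ncard_le (p.toSubgraph.neighborSet_subset a)
    ((hG a).trans_eq (hp.ncard_neighborSet_toSubgraph_eq_two ha).symm)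
  have hb : b ∈ p.toSubgraph.neighborSet a := h ▸ hab
  exact Walk.adj_toSubgraph_iff_mem_edges.1 hb

theorem edges_subset_of_ncard_le_two [Finite V] {G : SimpleGraph V}
    (hG : ∀ v, (G.neighborSet v).ncard ≤ 2) {u v : V} {p : G.Walk u u} {q : G.Walk v v}
    (hq : q.IsCycle) (h : G.Reachable u v) {e : Sym2 V} (he : e ∈ p.edges) : e ∈ q.edges := by
  classical
  have hmem : ∀ {a b : V}, G.Reachable a b → b ∈ q.support → a ∈ q.support := by
    rintro a b ⟨w⟩ hb
    induction w with
    | nil => exact hb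
    | cons hadj _ ih =>
      exact q.snd_mem_support_of_mem_edges (mk_mem_edges_of_ncard_le_two hG hq (ih hb) hadj.symm)
  induction e with | _ a b
  have hua := (p.takeUntil a (p.fst_mem_support_of_mem_edges he)).reachable
  exact mk_mem_edges_of_ncard_le_two hG hq (hmem (hua.symm.trans h) q.start_mem_support)
    (p.adj_of_mem_edges he)

theorem isPseudoforest_of_ncard_le_two [Finite V] {G : SimpleGraph V}
    (hG : ∀ v, (G.neighborSet v).ncard ≤ 2) : IsPseudoforest G := fun _ _ _ _ hp hq h =>
  Set.ext fun _ =>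
    ⟨edges_subset_of_ncard_le_two hG hq h, edges_subset_of_ncard_le_two hG hp h.symm⟩

theorem OrientedBy.ncard_le_two [Finite V] {G : SimpleGraph V} {f : V → V}
    (hf : OrientedBy G f) (h1 : ∀ v, (G.neighborSet v).ncard ≠ 1) (v : V) :
    (G.neighborSet v).ncard ≤ 2 := by
  classical
  have := Fintype.ofFinite V
  have hdeg (v : V) : (G.neighborSet v).ncard = G.degree v := by
    rw [Set.ncard_eq_toFinset_card', ← G.card_neighborFinset_eq_degree, neighborFinset]
  simp only [hdeg] at h1 ⊢
  by_contra! hv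
  let S : Finset V := Finset.univ.filter fun x => G.degree x ≠ 0
  have hE : G.edgeFinset ⊆ S.image fun x => s(x, f x) := by
    intro e he
    induction e with | _ a b
    rw [mem_edgeFinset, mem_edgeSet] at he
    have ha : a ∈ S := by
      simpa [S, ← Nat.pos_iff_ne_zero] using (G.degree_pos_iff_exists_adj a).2 ⟨b, he⟩
    have hb : b ∈ S := by
      simpa [S, ← Nat.pos_iff_ne_zero] using (G.degree_pos_iff_exists_adj b).2 ⟨a, he.symm⟩
    rcases hf he with h | h
    · exact Finset.mem_image.2 ⟨a, ha, by rw [h]⟩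
    · exact Finset.mem_image.2 ⟨b, hb, by rw [h, Sym2.eq_swap]⟩
  have hcard : G.edgeFinset.card ≤ S.card := (Finset.card_le_card hE).trans Finset.card_image_le
  have hsum : ∑ x ∈ S, G.degree x = 2 * G.edgeFinset.card := by
    rw [← G.sum_degrees_eq_twice_card_edges, Finset.sum_filter_ne_zero]
  have hlt : ∑ _x ∈ S, 2 < ∑ x ∈ S, G.degree x := by
    refine Finset.sum_lt_sum (fun x hx => ?_) ⟨v, by simp [S]; lia, hv⟩
    have := h1 x
    have : G.degree x ≠ 0 := (Finset.mem_filter.1 hx).2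
    lia
  simp only [Finset.sum_const, smul_eq_mul] at hlt
  lia

theorem switched_adj {G : SimpleGraph V} {a b c d x y : V} :
    (switched G a b c d).Adj x y ↔
      (G.Adj x y ∧ ¬ (x = a ∧ y = b ∨ x = b ∧ y = a) ∧ ¬ (x = c ∧ y = d ∨ x = d ∧ y = c) ∨
        (x = a ∧ y = c ∨ x = c ∧ y = a) ∨ (x = b ∧ y = d ∨ x = d ∧ y = b)) ∧ x ≠ y := by
  simp only [switched, fromEdgeSet_adj, Set.mem_union, Set.mem_sdiff, Set.mem_insert_iff,
    Set.mem_singleton_iff, mem_edgeSet, Sym2.eq_iff, not_or, ne_eq]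

theorem IsSwitchPair.symm {G : SimpleGraph V} {a b c d : V} (h : IsSwitchPair G a b c d) :
    IsSwitchPair (switched G a b c d) a c b d ∧
      switched (switched G a b c d) a c b d = G := by
  obtain ⟨hab, hac, had, hbc, hbd, hcd, h1, h2, h3, h4⟩ := h
  refine ⟨⟨hac, hab, had, hbc.symm, hcd, hbd, ?_, ?_, ?_, ?_⟩, ?_⟩
  any_goals simp only [switched_adj]; grind
  ext x y
  simp only [switched_adj]
  have := h1.symm
  have := h2.symm
  have := fun h : G.Adj c a => h3 h.symm
  have := fun h : G.Adj d b => h4 h.symm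
  have := fun h : G.Adj x y => h.ne
  grind (splits := 20)

theorem TwoSwitch.symm {G H : SimpleGraph V} (h : TwoSwitch G H) : TwoSwitch H G := by
  obtain ⟨a, b, c, d, h, rfl⟩ := h
  exact ⟨a, c, b, d, h.symm.1, h.symm.2.symm⟩

theorem TwoSwitch.ncard_neighborSet {G H : SimpleGraph V} (h : TwoSwitch G H) (v : V) :
    (H.neighborSet v).ncard = (G.neighborSet v).ncard := by
  obtain ⟨a, b, c, d, ⟨hab, hac, had, hbc, hbd, hcd, h1, h2, h3, h4⟩, rfl⟩ := h
  have key (x y z : V) (hy : G.Adj x y) (hz : ¬ G.Adj x z)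
      (h : ∀ t, (switched G a b c d).Adj x t ↔ t = z ∨ G.Adj x t ∧ t ≠ y) :
      ((switched G a b c d).neighborSet x).ncard = (G.neighborSet x).ncard := by
    rw [← Set.ncard_exchange (s := G.neighborSet x) hz hy]
    congr 1
    ext t
    simpa using h t
  have hn := fun t (h : G.Adj v t) => h.ne
  by_cases hva : v = a
  · subst hva
    exact key _ b c h1 h3 fun t => by simp only [switched_adj]; grind
  by_cases hvb : v = b
  · subst hvb
    exact key _ a d h1.symm h4 fun t => by simp only [switched_adj]; grind
  by_cases hvc : v = c
  · subst hvc
    exact key _ d a h2 (fun h => h3 h.symm) fun t => by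
      simp only [switched_adj]; grind
  by_cases hvd : v = d
  · subst hvd
    exact key _ c b h2.symm (fun h => h4 h.symm) fun t => by
      simp only [switched_adj]; grind
  congr 1
  ext t
  simp only [mem_neighborSet, switched_adj]
  grind

/-- `G` with all edges at `v` removed. -/
def isolate (G : SimpleGraph V) (v : V) : SimpleGraph V where
  Adj a b := G.Adj a b ∧ a ≠ v ∧ b ≠ v
  symm := ⟨fun _ _ h => ⟨h.1.symm, h.2.2, h.2.1⟩⟩
  loopless := ⟨fun _ h => h.1.ne rfl⟩

theorem isolate_le (G : SimpleGraph V) (v : V) : isolate G v ≤ G := fun _ _ h => h.1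

theorem isolate_sup_sdiff (G : SimpleGraph V) (v : V) : isolate G v ⊔ G \ isolate G v = G :=
  sup_sdiff_cancel_right (isolate_le G v)

theorem sdiff_isolate_congr {G H : SimpleGraph V} {v : V}
    (h : G.neighborSet v = H.neighborSet v) : G \ isolate G v = H \ isolate H v := by
  have h' (x : V) : G.Adj v x ↔ H.Adj v x := Set.ext_iff.1 h x
  ext a b
  have h1 := h' a
  have h2 := h' b
  rw [G.adj_comm, H.adj_comm] at h1
  simp only [sdiff_adj, isolate]
  grind

theorem ncard_neighborSet_isolate_congr [Finite V] {G H : SimpleGraph V} {v : V}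
    (h : G.neighborSet v = H.neighborSet v)
    (hdeg : ∀ x, (G.neighborSet x).ncard = (H.neighborSet x).ncard) (x : V) :
    ((isolate G v).neighborSet x).ncard = ((isolate H v).neighborSet x).ncard := by
  have hset (K : SimpleGraph V) (hx : x ≠ v) : (isolate K v).neighborSet x =
      K.neighborSet x \ {v} := by
    ext t
    simp [isolate, hx]
  by_cases hx : x = v
  · simp [neighborSet, isolate, hx]
  have hv : v ∈ G.neighborSet x ↔ v ∈ H.neighborSet x := by
    simpa [adj_comm] using Set.ext_iff.1 h x
  rw [hset G hx, hset H hx]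
  by_cases hG : v ∈ G.neighborSet x
  · rw [Set.ncard_sdiff_singleton_of_mem hG, Set.ncard_sdiff_singleton_of_mem (hv.1 hG), hdeg]
  · rw [Set.sdiff_singleton_eq_self hG, Set.sdiff_singleton_eq_self fun h => hG (hv.2 h), hdeg]

/-- Switches away from an isolated vertex are not affected by adding edges at that vertex. -/
theorem TwoSwitch.sup {G H K : SimpleGraph V} {v : V} (h : TwoSwitch G H)
    (hv : ∀ x, ¬ G.Adj v x) (hK : ∀ a b, K.Adj a b → a = v ∨ b = v) :
    TwoSwitch (G ⊔ K) (H ⊔ K) := by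
  obtain ⟨a, b, c, d, ⟨hab, hac, had, hbc, hbd, hcd, h1, h2, h3, h4⟩, rfl⟩ := h
  have ha : a ≠ v := by rintro rfl; exact hv _ h1
  have hb : b ≠ v := by rintro rfl; exact hv _ h1.symm
  have hc : c ≠ v := by rintro rfl; exact hv _ h2
  have hd : d ≠ v := by rintro rfl; exact hv _ h2.symm
  refine ⟨a, b, c, d, ⟨hab, hac, had, hbc, hbd, hcd, Or.inl h1, Or.inl h2, ?_, ?_⟩, ?_⟩
  · rintro (h | h)
    · exact h3 h
    · exact (hK _ _ h).elim ha hc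
  · rintro (h | h)
    · exact h4 h
    · exact (hK _ _ h).elim hb hd
  · ext x y
    have := hK x y
    have := fun h : K.Adj x y => h.ne
    simp only [switched_adj, sup_adj]
    grind

theorem TwoSwitch.not_adj [Finite V] {G H : SimpleGraph V} (h : TwoSwitch G H) {v : V}
    (hv : ∀ x, ¬ G.Adj v x) (x : V) : ¬ H.Adj v x := by
  have h0 : G.neighborSet v = ∅ := Set.eq_empty_of_forall_notMem hv
  have h1 : H.neighborSet v = ∅ := by
    rw [← Set.ncard_eq_zero, h.ncard_neighborSet, h0, Set.ncard_empty]
  exact Set.eq_empty_iff_forall_notMem.1 h1 x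

/-- `G` and `H` both satisfy `P`, and `H` is obtained from `G` by a 2-switch. -/
def SwitchIn (P : SimpleGraph V → Prop) (G H : SimpleGraph V) : Prop :=
  TwoSwitch G H ∧ P G ∧ P H

theorem SwitchIn.symm {P : SimpleGraph V → Prop} {G H : SimpleGraph V} (h : SwitchIn P G H) :
    SwitchIn P H G :=
  ⟨h.1.symm, h.2.2, h.2.1⟩

theorem reflTransGen_switchIn_symm {P : SimpleGraph V → Prop} {G H : SimpleGraph V}
    (h : Relation.ReflTransGen (SwitchIn P) G H) : Relation.ReflTransGen (SwitchIn P) H G :=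
  Relation.ReflTransGen.mono (fun _ _ => SwitchIn.symm) _ _ h.swap

theorem ncard_neighborSet_of_reflTransGen {P : SimpleGraph V → Prop} {G H : SimpleGraph V}
    (h : Relation.ReflTransGen (SwitchIn P) G H) (v : V) :
    (H.neighborSet v).ncard = (G.neighborSet v).ncard := by
  induction h with
  | refl => rfl
  | tail _ h ih => rw [h.1.ncard_neighborSet, ih]

theorem reflTransGen_switchIn_sup [Finite V] {P : SimpleGraph V → Prop} {G H K : SimpleGraph V}
    {v : V} (h : Relation.ReflTransGen (SwitchIn P) G H) (hv : ∀ x, ¬ G.Adj v x)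
    (hK : ∀ a b, K.Adj a b → a = v ∨ b = v)
    (hP : ∀ G', P G' → (∀ x, ¬ G'.Adj v x) → P (G' ⊔ K)) :
    Relation.ReflTransGen (SwitchIn P) (G ⊔ K) (H ⊔ K) := by
  induction h using Relation.ReflTransGen.head_induction_on with
  | refl => exact .refl
  | head h _ ih =>
    exact .head ⟨h.1.sup hv hK, hP _ h.2.1 hv, hP _ h.2.2 (h.1.not_adj hv)⟩ (ih (h.1.not_adj hv))

theorem reflTransGen_switchIn_of_isolate [Finite V] {P : SimpleGraph V → Prop}
    {G H : SimpleGraph V} {v : V} (hGH : G.neighborSet v = H.neighborSet v)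
    (hP : ∀ G', P G' → (∀ x, ¬ G'.Adj v x) → P (G' ⊔ G \ isolate G v))
    (h : Relation.ReflTransGen (SwitchIn P) (isolate G v) (isolate H v)) :
    Relation.ReflTransGen (SwitchIn P) G H := by
  have := reflTransGen_switchIn_sup (v := v) h (fun _ h => h.2.1 rfl) (fun a b hab => ?_) hP
  · rwa [isolate_sup_sdiff, sdiff_isolate_congr hGH, isolate_sup_sdiff] at this
  · by_contra! hne
    exact hab.2 ⟨hab.1, hne⟩

theorem exists_adj_not_adj [Finite V] {G : SimpleGraph V} {u v w : V} (hvu : G.Adj v u)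
    (hvw : ¬ G.Adj v w) (hne : v ≠ w)
    (hdeg : (G.neighborSet u).ncard ≤ (G.neighborSet w).ncard) :
    ∃ x, G.Adj w x ∧ x ≠ u ∧ ¬ G.Adj u x := by
  by_contra! h
  have hlt : (G.neighborSet w \ {u}).ncard < (G.neighborSet u \ {w}).ncard := by
    refine Set.ncard_lt_ncard (Set.ssubset_iff_of_subset ?_ |>.2 ⟨v, ⟨hvu.symm, hne⟩, ?_⟩)
    · exact fun x hx => ⟨h x hx.1 hx.2, fun hxw => hx.1.ne (Set.mem_singleton_iff.1 hxw).symm⟩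
    · exact fun hv => hvw (G.adj_symm hv.1)
  by_cases huw : G.Adj u w
  · rw [Set.ncard_sdiff_singleton_of_mem (show u ∈ G.neighborSet w from huw.symm),
      Set.ncard_sdiff_singleton_of_mem (show w ∈ G.neighborSet u from huw)] at hlt
    lia
  · rw [Set.sdiff_singleton_eq_self (show u ∉ G.neighborSet w from fun h => huw h.symm),
      Set.sdiff_singleton_eq_self (show w ∉ G.neighborSet u from huw)] at hlt
    lia

theorem isSwitchPair_of_adj {G : SimpleGraph V} {u v w x : V} (hvu : G.Adj v u)
    (hvw : ¬ G.Adj v w) (hne : v ≠ w) (hwx : G.Adj w x) (hxu : x ≠ u) (hux : ¬ G.Adj u x) :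
    IsSwitchPair G v u w x :=
  ⟨hvu.ne, hne, fun h => hvw (h ▸ hwx.symm), fun h => hvw (h ▸ hvu), hxu.symm, hwx.ne, hvu, hwx,
    hvw, hux⟩

theorem IsSwitchPair.neighborSet_switched {G : SimpleGraph V} {u v w x : V}
    (h : IsSwitchPair G v u w x) :
    (switched G v u w x).neighborSet v = insert w (G.neighborSet v \ {u}) := by
  obtain ⟨h1, h2, h3, h4, h5, h6, hvu, -⟩ := h
  ext t
  have := fun h : G.Adj v t => h.ne
  simp only [mem_neighborSet, switched_adj, Set.mem_insert_iff, Set.mem_sdiff,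
    Set.mem_singleton_iff]
  grind

theorem exists_neighborSet_eq [Finite V] (v : V) (G H : SimpleGraph V)
    (hdeg : ∀ x, (G.neighborSet x).ncard = (H.neighborSet x).ncard) :
    ∃ G' H', Relation.ReflTransGen (SwitchIn fun _ => True) G G' ∧
      Relation.ReflTransGen (SwitchIn fun _ => True) H H' ∧
      G'.neighborSet v = H'.neighborSet v := by
  induction hn : (G.neighborSet v \ H.neighborSet v).ncard using Nat.strong_induction_on
    generalizing G H with | _ n ih
  by_cases heq : G.neighborSet v = H.neighborSet v
  · exact ⟨G, H, .refl, .refl, heq⟩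
  obtain ⟨u, hu, hu'⟩ : (G.neighborSet v \ H.neighborSet v).Nonempty := by
    rw [Set.sdiff_nonempty]
    exact fun h => heq (Set.eq_of_subset_of_ncard_le h (hdeg v).ge)
  obtain ⟨w, hw, hw'⟩ : (H.neighborSet v \ G.neighborSet v).Nonempty := by
    rw [Set.sdiff_nonempty]
    exact fun h => heq (Set.eq_of_subset_of_ncard_le h (hdeg v).le).symm
  rcases le_total (G.neighborSet u).ncard (G.neighborSet w).ncard with hle | hle
  · obtain ⟨x, hwx, hxu, hux⟩ := exists_adj_not_adj hu hw' hw.ne hle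
    have hsw := isSwitchPair_of_adj hu hw' hw.ne hwx hxu hux
    have hts : TwoSwitch G (switched G v u w x) := ⟨_, _, _, _, hsw, rfl⟩
    obtain ⟨G', H', h1, h2, h3⟩ := ih _ (by
      rw [← hn, hsw.neighborSet_switched]
      refine Set.ncard_lt_ncard (Set.ssubset_iff_of_subset ?_ |>.2 ⟨u, ⟨hu, hu'⟩, ?_⟩)
      all_goals grind) (switched G v u w x) H
      (fun y => (hts.ncard_neighborSet y).trans (hdeg y)) rfl
    exact ⟨G', H', .head ⟨hts, trivial, trivial⟩ h1, h2, h3⟩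
  · rw [hdeg, hdeg] at hle
    obtain ⟨x, hwx, hxu, hux⟩ := exists_adj_not_adj hw hu' hu.ne hle
    have hsw := isSwitchPair_of_adj hw hu' hu.ne hwx hxu hux
    have hts : TwoSwitch H (switched H v w u x) := ⟨_, _, _, _, hsw, rfl⟩
    obtain ⟨G', H', h1, h2, h3⟩ := ih _ (by
      rw [← hn, hsw.neighborSet_switched]
      refine Set.ncard_lt_ncard (Set.ssubset_iff_of_subset ?_ |>.2 ⟨u, ⟨hu, hu'⟩, ?_⟩)
      all_goals grind) G (switched H v w u x)
      (fun y => (hdeg y).trans (hts.ncard_neighborSet y).symm) rfl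
    exact ⟨G', H', h1, .head ⟨hts, trivial, trivial⟩ h2, h3⟩

theorem ncard_neighborSet_isolate_eq_zero [Finite V] {G : SimpleGraph V} {v : V} {S : Set V}
    (hS : ∀ x ∉ S, (G.neighborSet x).ncard = 0) :
    ∀ x ∉ S \ {v}, ((isolate G v).neighborSet x).ncard = 0 := by
  intro x hx
  by_cases hxv : x = v
  · simp [neighborSet, isolate, hxv]
  · exact Nat.eq_zero_of_le_zero ((Set.ncard_le_ncard fun t ht => isolate_le G v ht).trans_eq
      (hS x fun h => hx ⟨h, hxv⟩))

theorem eq_of_ncard_neighborSet_eq_zero [Finite V] {G H : SimpleGraph V}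
    (hG : ∀ v, (G.neighborSet v).ncard = 0)
    (hdeg : ∀ v, (G.neighborSet v).ncard = (H.neighborSet v).ncard) : G = H := by
  ext a b
  have h1 := hG a
  have h2 := (hdeg a).symm.trans h1
  rw [Set.ncard_eq_zero] at h1 h2
  exact Set.ext_iff.1 (h1.trans h2.symm) b

/-- Any two graphs with the same degrees are connected by 2-switches. -/
theorem reflTransGen_switchIn_true [Finite V] (G H : SimpleGraph V)
    (hdeg : ∀ x, (G.neighborSet x).ncard = (H.neighborSet x).ncard) :
    Relation.ReflTransGen (SwitchIn fun _ => True) G H := by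
  obtain ⟨S, hS⟩ : ∃ S : Set V, ∀ x ∉ S, (G.neighborSet x).ncard = 0 := ⟨Set.univ, by simp⟩
  induction S using WellFoundedLT.induction generalizing G H with | _ S ih
  by_cases h0 : ∀ v, (G.neighborSet v).ncard = 0
  · rw [eq_of_ncard_neighborSet_eq_zero h0 hdeg]
  push Not at h0
  obtain ⟨v, hv⟩ := h0
  have hvS : v ∈ S := by
    by_contra h
    exact hv (hS v h)
  obtain ⟨G', H', hG, hH, heq⟩ := exists_neighborSet_eq v G H hdeg
  have hG' := ncard_neighborSet_of_reflTransGen hG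
  have hH' := ncard_neighborSet_of_reflTransGen hH
  refine hG.trans (.trans (reflTransGen_switchIn_of_isolate heq (fun _ _ _ => trivial) ?_)
    (reflTransGen_switchIn_symm hH))
  refine ih (S \ {v}) (Set.sdiff_singleton_ssubset.2 hvS) _ _
    (ncard_neighborSet_isolate_congr heq fun x => by rw [hG', hH', hdeg])
    (ncard_neighborSet_isolate_eq_zero fun x hx => by rw [hG', hS x hx])

theorem reflTransGen_switchIn_isPseudoforest_of_ncard_le_two [Finite V] {G H : SimpleGraph V}
    (hdeg : ∀ x, (G.neighborSet x).ncard = (H.neighborSet x).ncard)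
    (hG : ∀ x, (G.neighborSet x).ncard ≤ 2) :
    Relation.ReflTransGen (SwitchIn IsPseudoforest) G H := by
  have h := reflTransGen_switchIn_true G H hdeg
  clear hdeg
  induction h using Relation.ReflTransGen.head_induction_on with
  | refl => exact .refl
  | head h _ ih =>
    have hc := fun x => (h.1.ncard_neighborSet x).trans_le (hG x)
    exact .head ⟨h.1, isPseudoforest_of_ncard_le_two hG, isPseudoforest_of_ncard_le_two hc⟩
      (ih hc)

open Classical in
/-- An edge at a leaf can be switched to any vertex whose degree is at least that of the
neighbour of the leaf, keeping the graph a pseudoforest. -/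
theorem IsPseudoforest.exists_switchIn_leaf [Finite V] {G : SimpleGraph V}
    (hG : IsPseudoforest G) {u v w : V} (hv : G.neighborSet v = {u}) (hvw : v ≠ w) (huw : u ≠ w)
    (hdeg : (G.neighborSet u).ncard ≤ (G.neighborSet w).ncard) :
    ∃ H, SwitchIn IsPseudoforest G H ∧ H.neighborSet v = {w} := by
  have hvt (t : V) : G.Adj v t ↔ t = u := Set.ext_iff.1 hv t
  have htv (t : V) : G.Adj t v ↔ t = u := by rw [G.adj_comm, hvt]
  have hwv (t : V) (h : G.Adj w t) : t ≠ v := fun h' => huw ((htv w).1 (h' ▸ h)).symm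
  have hvu : G.Adj v u := (hvt u).2 rfl
  have hnvw : ¬ G.Adj v w := fun h => huw ((hvt w).1 h).symm
  suffices h : ∃ x, (G.Adj w x ∧ x ≠ u ∧ ¬ G.Adj u x) ∧ ∃ f, OrientedBy (switched G v u w x) f by
    obtain ⟨x, ⟨hwx, hxu, hux⟩, f, hf⟩ := h
    have hsw := isSwitchPair_of_adj hvu hnvw hvw hwx hxu hux
    refine ⟨_, ⟨⟨_, _, _, _, hsw, rfl⟩, hG, hf.isPseudoforest⟩, ?_⟩
    rw [hsw.neighborSet_switched, hv, Set.sdiff_self, insert_empty_eq]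
  obtain ⟨f, hf⟩ := isPseudoforest_iff_exists_orientedBy.1 hG
  by_cases hin : ∃ x, (G.Adj w x ∧ x ≠ u ∧ ¬ G.Adj u x) ∧ f x = w
  · obtain ⟨x, hx, hfx⟩ := hin
    refine ⟨x, hx, Function.update (Function.update f v w) x u, fun a b hab => ?_⟩
    rw [switched_adj] at hab
    have h1 := @hf a b
    have h2 := hvt a
    have h3 := hvt b
    have h4 := G.adj_comm a b
    grind [Function.update_apply]
  obtain ⟨x, hx⟩ := exists_adj_not_adj hvu hnvw hvw hdeg
  have hfx : f w = x := (hf hx.1).resolve_right fun h => hin ⟨x, hx, h⟩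
  have hxv := hwv x hx.1
  refine ⟨x, hx, ?_⟩
  by_cases hone : ∀ y, G.Adj w y → y = x
  · have hu : ∀ y, G.Adj u y → y = v := by
      have h1 : (G.neighborSet w).ncard ≤ 1 := by
        rw [Set.ncard_le_one]
        exact fun a ha b hb => (hone a ha).trans (hone b hb).symm
      have h2 := hdeg.trans h1
      rw [Set.ncard_le_one] at h2
      exact fun y hy => h2 y hy v hvu.symm
    refine ⟨Function.update (Function.update f v w) u x, fun a b hab => ?_⟩
    rw [switched_adj] at hab
    have h1 := @hf a b
    have h2 := hvt a
    have h3 := hvt b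
    have h4 := G.adj_comm a b
    have h5 := hu a
    have h6 := hu b
    obtain ⟨⟨hab, hne, -⟩ | (⟨rfl, rfl⟩ | ⟨rfl, rfl⟩) | ⟨rfl, rfl⟩ | ⟨rfl, rfl⟩, -⟩ := hab
    · have hba := hab.symm
      have hau : a ≠ u := by grind
      have hbu : b ≠ u := by grind
      have hav : a ≠ v := by grind
      have hbv : b ≠ v := by grind
      simpa [hau, hbu, hav, hbv] using h1 hab
    all_goals
      have hne := hvu.ne
      grind [Function.update_apply]
  push Not at hone
  obtain ⟨y, hwy, hyx⟩ := hone
  have hyv := hwv y hwy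
  have hfy : f y = w := (hf hwy).resolve_left fun h => hyx (h.symm.trans hfx)
  have hyu : y ≠ u → G.Adj u y := fun h => by
    by_contra h'
    exact hin ⟨y, ⟨hwy, h, h'⟩, hfy⟩
  by_cases hyu' : y = u
  · refine ⟨Function.update (Function.update (Function.update f v w) u x) w u, fun a b hab => ?_⟩
    rw [switched_adj] at hab
    have h1 := @hf a b
    have h2 := hvt a
    have h3 := hvt b
    have h4 := G.adj_comm a b
    grind [Function.update_apply]
  · have huy := hyu hyu'
    have hfu : f u = y := (hf huy).resolve_right fun h => huw (h.symm.trans hfy)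
    refine ⟨Function.update (Function.update (Function.update (Function.update f v w) w y) y u) u x,
      fun a b hab => ?_⟩
    rw [switched_adj] at hab
    have h1 := @hf a b
    have h2 := hvt a
    have h3 := hvt b
    have h4 := G.adj_comm a b
    grind (splits := 20) [Function.update_apply]

theorem exists_neighborSet_eq_of_leaf [Finite V] {G H : SimpleGraph V} (hG : IsPseudoforest G)
    (hH : IsPseudoforest H) (hdeg : ∀ x, (G.neighborSet x).ncard = (H.neighborSet x).ncard)
    {v : V} (hv : (G.neighborSet v).ncard = 1) :
    ∃ G' H', Relation.ReflTransGen (SwitchIn IsPseudoforest) G G' ∧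
      Relation.ReflTransGen (SwitchIn IsPseudoforest) H H' ∧ IsPseudoforest G' ∧
      IsPseudoforest H' ∧ G'.neighborSet v = H'.neighborSet v := by
  obtain ⟨u, hu⟩ := Set.ncard_eq_one.1 hv
  obtain ⟨w, hw⟩ := Set.ncard_eq_one.1 ((hdeg v).symm.trans hv)
  by_cases huw : u = w
  · exact ⟨G, H, .refl, .refl, hG, hH, by rw [hu, hw, huw]⟩
  have hvu : v ≠ u := fun h => G.irrefl (show v ∈ G.neighborSet v by rw [hu]; exact h)
  have hvw : v ≠ w := fun h => H.irrefl (show v ∈ H.neighborSet v by rw [hw]; exact h)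
  rcases le_total (G.neighborSet u).ncard (G.neighborSet w).ncard with hle | hle
  · obtain ⟨G', h, h'⟩ := hG.exists_switchIn_leaf hu hvw huw hle
    exact ⟨G', H, .single h, .refl, h.2.2, hH, h'.trans hw.symm⟩
  · rw [hdeg, hdeg] at hle
    obtain ⟨H', h, h'⟩ := hH.exists_switchIn_leaf hw hvu (Ne.symm huw) hle
    exact ⟨G, H', .refl, .single h, hG, h.2.2, hu.trans h'.symm⟩

open Classical in
theorem IsPseudoforest.sup_sdiff_isolate [Finite V] {G K : SimpleGraph V} {v : V}
    (hG : IsPseudoforest G) (hv : (K.neighborSet v).ncard = 1) (hGv : ∀ x, ¬ G.Adj v x) :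
    IsPseudoforest (G ⊔ K \ isolate K v) := by
  obtain ⟨u, hu⟩ := Set.ncard_eq_one.1 hv
  obtain ⟨f, hf⟩ := isPseudoforest_iff_exists_orientedBy.1 hG
  refine OrientedBy.isPseudoforest (f := Function.update f v u) fun a b hab => ?_
  have h1 := @hf a b
  have h2 : K.Adj v a ↔ a = u := Set.ext_iff.1 hu a
  have h3 : K.Adj v b ↔ b = u := Set.ext_iff.1 hu b
  have h4 := K.adj_comm a b
  have h5 := G.adj_comm a b
  have h6 := hGv a
  have h7 := hGv b
  simp only [sup_adj, sdiff_adj, isolate] at hab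
  grind [Function.update_apply]

theorem reflTransGen_switchIn_isPseudoforest [Finite V] {G H : SimpleGraph V}
    (hG : IsPseudoforest G) (hH : IsPseudoforest H)
    (hdeg : ∀ x, (G.neighborSet x).ncard = (H.neighborSet x).ncard) :
    Relation.ReflTransGen (SwitchIn IsPseudoforest) G H := by
  obtain ⟨S, hS⟩ : ∃ S : Set V, ∀ x ∉ S, (G.neighborSet x).ncard = 0 := ⟨Set.univ, by simp⟩
  induction S using WellFoundedLT.induction generalizing G H with | _ S ih
  by_cases h1 : ∀ v, (G.neighborSet v).ncard ≠ 1
  · obtain ⟨f, hf⟩ := isPseudoforest_iff_exists_orientedBy.1 hG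
    exact reflTransGen_switchIn_isPseudoforest_of_ncard_le_two hdeg (hf.ncard_le_two h1)
  push Not at h1
  obtain ⟨v, hv⟩ := h1
  have hvS : v ∈ S := by
    by_contra h
    have := hS v h
    lia
  obtain ⟨G', H', hGG', hHH', hpG, hpH, heq⟩ := exists_neighborSet_eq_of_leaf hG hH hdeg hv
  have hG' := ncard_neighborSet_of_reflTransGen hGG'
  have hH' := ncard_neighborSet_of_reflTransGen hHH'
  refine hGG'.trans (.trans (reflTransGen_switchIn_of_isolate heq
    (fun K hK hKv => hK.sup_sdiff_isolate ((hG' v).trans hv) hKv) ?_)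
    (reflTransGen_switchIn_symm hHH'))
  refine ih (S \ {v}) (Set.sdiff_singleton_ssubset.2 hvS) (hpG.mono (isolate_le _ _))
    (hpH.mono (isolate_le _ _))
    (ncard_neighborSet_isolate_congr heq fun x => by rw [hG', hH', hdeg])
    (ncard_neighborSet_isolate_eq_zero fun x hx => by rw [hG', hS x hx])

theorem exists_sequence_of_reflTransGen {P : SimpleGraph V → Prop} {G H : SimpleGraph V}
    (hG : P G) (h : Relation.ReflTransGen (SwitchIn P) G H) :
    ∃ (r : ℕ) (g : ℕ → SimpleGraph V), g 0 = G ∧ g r = H ∧ (∀ i ≤ r, P (g i)) ∧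
      ∀ i < r, TwoSwitch (g i) (g (i + 1)) := by
  induction h using Relation.ReflTransGen.head_induction_on with
  | refl => exact ⟨0, fun _ => H, rfl, rfl, fun _ _ => hG, by simp⟩
  | @head G _ h _ ih =>
    obtain ⟨r, g, h0, hr, hP, hg⟩ := ih h.2.2
    refine ⟨r + 1, fun i => i.casesOn G g, rfl, hr, ?_, ?_⟩
    · rintro (_ | i) hi
      · exact hG
      · exact hP i (by lia)
    · rintro (_ | i) hi
      · simpa [h0] using h.1
      · exact hg i (by lia)

/-- Any two pseudoforests on the same finite vertex set with the same
degree sequence are connected by a sequence of 2-switches all of whose intermediate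
graphs are pseudoforests. -/
theorem pseudoforests_connected_by_2switches {V : Type*} [Fintype V]
    (G H : SimpleGraph V) (hG : IsPseudoforest G) (hH : IsPseudoforest H)
    (hdeg : ∀ v : V, (G.neighborSet v).ncard = (H.neighborSet v).ncard) :
    ∃ (r : ℕ) (Gs : Fin (r + 1) → SimpleGraph V),
      Gs 0 = G ∧ Gs (Fin.last r) = H ∧
      (∀ i, IsPseudoforest (Gs i)) ∧
      (∀ i : Fin r, TwoSwitch (Gs i.castSucc) (Gs i.succ)) := by
  obtain ⟨r, g, h0, hr, hP, hg⟩ :=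
    exists_sequence_of_reflTransGen hG (reflTransGen_switchIn_isPseudoforest hG hH hdeg)
  exact ⟨r, fun i => g i, h0, hr, fun i => hP i (Nat.lt_succ_iff.1 i.2), fun i => hg i i.2⟩
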